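/- arXiv:2001.11791 — 4 statements merged into one kernel-verified Lean document; each statement's English description precedes it below -/
import Mathlib

section
/- Let G be a finite group, let t ≥ 1, and let P₁, …, P_t be subgroups of G such that the orders |P_i| are pairwise coprime and the subgroups pairwise permute, i.e., P_i P_j = P_j P_i as subsets of G for all i, j. Then for every subset J of {1, …, t}, the subgroup H_J generated by the P_i with i ∈ J has order ∏_{i ∈ J} |P_i|. -/
open scoped Pointwise

theorem coe_sup_of_permute {G : Type*} [Group G] (H K : Subgroup G)
    (h : (H : Set G) * (K : Set G) = (K : Set G) * (H : Set G)) :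
    ((H ⊔ K : Subgroup G) : Set G) = (H : Set G) * (K : Set G) := by
  let L : Subgroup G :=
    { carrier := (H : Set G) * (K : Set G)
      one_mem' := ⟨1, H.one_mem, 1, K.one_mem, one_mul 1⟩
      mul_mem' := by
        intro a b ha hb
        have e : ((H : Set G) * K) * ((H : Set G) * K) = (H : Set G) * K := by
          calc ((H : Set G) * K) * ((H : Set G) * K)
              = (H : Set G) * ((K : Set G) * H) * K := by simp only [mul_assoc]
            _ = ((H : Set G) * H) * ((K : Set G) * K) := by rw [← h]; simp only [mul_assoc]
            _ = (H : Set G) * K := by simp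
        rw [← e]
        exact Set.mul_mem_mul ha hb
      inv_mem' := by
        rintro _ ⟨x, hx, y, hy, rfl⟩
        rw [h]
        exact ⟨y⁻¹, K.inv_mem hy, x⁻¹, H.inv_mem hx, by simp⟩ }
  apply Set.Subset.antisymm
  · have : H ⊔ K ≤ L := sup_le
      (fun x hx => ⟨x, hx, 1, K.one_mem, mul_one x⟩)
      (fun x hx => ⟨1, H.one_mem, x, hx, one_mul x⟩)
    exact this
  · rintro _ ⟨x, hx, y, hy, rfl⟩
    exact (H ⊔ K).mul_mem (Subgroup.mem_sup_left hx) (Subgroup.mem_sup_right hy)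

theorem card_sup_of_permute {G : Type*} [Group G] (H K : Subgroup G)
    (h : (H : Set G) * (K : Set G) = (K : Set G) * (H : Set G))
    (hc : Nat.Coprime (Nat.card H) (Nat.card K)) :
    Nat.card (H ⊔ K : Subgroup G) = Nat.card H * Nat.card K := by
  have hd : Disjoint H K := by
    rw [disjoint_iff]
    exact Subgroup.inf_eq_bot_of_coprime hc
  have hi := Subgroup.mul_injective_of_disjoint hd
  rw [← Nat.card_prod, ← Nat.card_range_of_injective hi]
  have : ((H ⊔ K : Subgroup G) : Set G) = Set.range (fun g : H × K => (g.1 : G) * g.2) := by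
    rw [coe_sup_of_permute H K h]
    ext x
    simp [Set.mem_mul]
  exact congrArg (fun s : Set G => Nat.card s) this

/-- If `P₁, …, P_t` are pairwise permuting subgroups of a finite group `G` with pairwise
coprime orders, then for every subset `J ⊆ {1, …, t}` the subgroup generated by the `P_i`
with `i ∈ J` has order `∏_{i ∈ J} |P_i|`. -/
theorem stmt_5 {G : Type*} [Group G] [Finite G] (t : ℕ) (ht : 1 ≤ t)
    (P : Fin t → Subgroup G)
    (hcop : ∀ i j, i ≠ j → Nat.Coprime (Nat.card (P i)) (Nat.card (P j)))
    (hperm : ∀ i j, (P i : Set G) * (P j : Set G) = (P j : Set G) * (P i : Set G))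
    (J : Finset (Fin t)) :
    Nat.card (⨆ i ∈ J, P i : Subgroup G) = ∏ i ∈ J, Nat.card (P i) := by
  suffices hs : Nat.card (⨆ i ∈ J, P i : Subgroup G) = ∏ i ∈ J, Nat.card (P i) ∧
      ∀ k, (P k : Set G) * ((⨆ i ∈ J, P i : Subgroup G) : Set G)
        = ((⨆ i ∈ J, P i : Subgroup G) : Set G) * (P k : Set G) from hs.1
  induction J using Finset.induction_on with
  | empty => simp
  | insert a s ha ih =>
    obtain ⟨ih1, ih2⟩ := ih
    rw [Finset.iSup_insert, Finset.prod_insert ha]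
    refine ⟨?_, fun k => ?_⟩
    · rw [card_sup_of_permute _ _ (ih2 a), ih1]
      rw [ih1]
      exact Nat.Coprime.prod_right fun i hi => hcop a i (by rintro rfl; exact ha hi)
    · rw [coe_sup_of_permute _ _ (ih2 a), ← mul_assoc, hperm k a, mul_assoc, ih2 k, mul_assoc]
end

section
/- Let G be a finite group, let t ≥ 1, and let P₁, …, P_t be nontrivial subgroups of G such that the orders |P_i| are pairwise coprime and the subgroups pairwise permute, i.e., P_i P_j = P_j P_i as subsets of G for all i, j. For J ⊆ {1, …, t} let H_J be the subgroup generated by the P_i with i ∈ J. Then for all subsets J₁, J₂ of {1, …, t}, H_{J₁} ≤ H_{J₂} if and only if J₁ ⊆ J₂; in particular the map J ↦ H_J is injective, so G has at least 2^t subgroups of this form. -/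
open scoped Pointwise

theorem sup_coe_of_commute {G : Type*} [Group G] (H K : Subgroup G)
    (h : Commute (H : Set G) (K : Set G)) :
    ((H ⊔ K : Subgroup G) : Set G) = (H : Set G) * (K : Set G) := by
  have h' : (H : Set G) * (K : Set G) = (K : Set G) * (H : Set G) := h
  let L : Subgroup G :=
    { carrier := (H : Set G) * (K : Set G)
      one_mem' := ⟨1, H.one_mem, 1, K.one_mem, by simp⟩
      mul_mem' := by
        intro a b ha hb
        have : a * b ∈ ((H : Set G) * (K : Set G)) * ((H : Set G) * (K : Set G)) :=
          Set.mul_mem_mul ha hb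
        rw [mul_assoc, ← mul_assoc (K : Set G), ← h', mul_assoc (H : Set G), coe_mul_coe,
          ← mul_assoc, coe_mul_coe] at this
        exact this
      inv_mem' := by
        rintro _ ⟨x, hx, y, hy, rfl⟩
        rw [h']
        exact ⟨y⁻¹, K.inv_mem hy, x⁻¹, H.inv_mem hx, by simp⟩ }
  apply subset_antisymm
  · have : H ⊔ K ≤ L := sup_le (fun x hx => ⟨x, hx, 1, K.one_mem, by simp⟩)
      (fun x hx => ⟨1, H.one_mem, x, hx, by simp⟩)
    exact this
  · rintro _ ⟨x, hx, y, hy, rfl⟩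
    exact Subgroup.mul_mem_sup hx hy

theorem card_sup_dvd_of_commute {G : Type*} [Group G] [Finite G] (H K : Subgroup G)
    (h : Commute (H : Set G) (K : Set G)) :
    Nat.card (H ⊔ K : Subgroup G) ∣ Nat.card H * Nat.card K := by
  have h1 := Subgroup.card_mul_eq_card_subgroup_mul_card_quotient H (K : Set G)
  have h2 : Nat.card (H ⊔ K : Subgroup G) = Nat.card ((K : Set G) * (H : Set G) : Set G) := by
    rw [← h.eq, ← sup_coe_of_commute H K h]; rfl
  rw [h2, h1]
  apply mul_dvd_mul_left
  have h3 : ((QuotientGroup.mk : G → G ⧸ H) '' (K : Set G)) =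
      MulAction.orbit K ((1 : G) : G ⧸ H) := by
    ext q
    constructor
    · rintro ⟨k, hk, rfl⟩
      refine ⟨⟨k, hk⟩, ?_⟩
      change ((k * 1 : G) : G ⧸ H) = _
      simp
    · rintro ⟨⟨k, hk⟩, rfl⟩
      refine ⟨k, hk, ?_⟩
      change _ = ((k * 1 : G) : G ⧸ H)
      simp
  rw [h3, Nat.card_congr (MulAction.orbitEquivQuotientStabilizer K ((1 : G) : G ⧸ H))]
  exact Subgroup.card_quotient_dvd_card _

theorem join_commute {G ι : Type*} [Group G] (P : ι → Subgroup G)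
    (hperm : ∀ i j, Commute (P i : Set G) (P j : Set G)) (J : Finset ι) (k : ι) :
    Commute (P k : Set G) ((⨆ i ∈ J, P i : Subgroup G) : Set G) := by
  classical
  induction J using Finset.induction_on generalizing k with
  | empty => simp [Commute, SemiconjBy]
  | insert a J ha ih =>
    rw [Finset.iSup_insert, sup_coe_of_commute _ _ (ih a)]
    exact (hperm k a).mul_right (ih k)

theorem card_join_dvd {G ι : Type*} [Group G] [Finite G] (P : ι → Subgroup G)
    (hperm : ∀ i j, Commute (P i : Set G) (P j : Set G)) (J : Finset ι) :
    Nat.card (⨆ i ∈ J, P i : Subgroup G) ∣ ∏ i ∈ J, Nat.card (P i) := by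
  classical
  induction J using Finset.induction_on with
  | empty => simp
  | insert a J ha ih =>
    rw [Finset.iSup_insert, Finset.prod_insert ha]
    exact (card_sup_dvd_of_commute _ _ (join_commute P hperm J a)).trans (mul_dvd_mul_left _ ih)

/-- If `P₁, …, P_t` are nontrivial pairwise permuting subgroups of a finite group `G` with
pairwise coprime orders, and `H_J = ⟨P_i : i ∈ J⟩`, then `H_{J₁} ≤ H_{J₂} ↔ J₁ ⊆ J₂`;
in particular `J ↦ H_J` is injective, so `G` has at least `2^t` subgroups of this form. -/
theorem stmt_6 {G : Type*} [Group G] [Finite G] (t : ℕ) (ht : 1 ≤ t)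
    (P : Fin t → Subgroup G)
    (hnt : ∀ i, P i ≠ ⊥)
    (hcop : ∀ i j, i ≠ j → Nat.Coprime (Nat.card (P i)) (Nat.card (P j)))
    (hperm : ∀ i j, (P i : Set G) * (P j : Set G) = (P j : Set G) * (P i : Set G)) :
    (∀ J₁ J₂ : Finset (Fin t), (⨆ i ∈ J₁, P i) ≤ ⨆ i ∈ J₂, P i ↔ J₁ ⊆ J₂) ∧
    Function.Injective (fun J : Finset (Fin t) => ⨆ i ∈ J, P i) ∧
    2 ^ t ≤ Nat.card {H : Subgroup G | ∃ J : Finset (Fin t), H = ⨆ i ∈ J, P i} := by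
  have key : ∀ J₁ J₂ : Finset (Fin t), (⨆ i ∈ J₁, P i) ≤ ⨆ i ∈ J₂, P i ↔ J₁ ⊆ J₂ := by
    intro J₁ J₂
    constructor
    · intro h i hi
      by_contra hn
      have h1 : P i ≤ ⨆ j ∈ J₂, P j := (le_iSup₂_of_le i hi le_rfl).trans h
      have h2 := (Subgroup.card_dvd_of_le h1).trans (card_join_dvd P hperm J₂)
      have h3 : Nat.Coprime (Nat.card (P i)) (∏ j ∈ J₂, Nat.card (P j)) :=
        Nat.Coprime.prod_right fun j hj => hcop i j (by rintro rfl; exact hn hj)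
      exact hnt i (Subgroup.card_eq_one.mp (Nat.eq_one_of_dvd_coprimes h3 dvd_rfl h2))
    · intro h
      exact biSup_mono fun i hi => h hi
  have inj : Function.Injective (fun J : Finset (Fin t) => ⨆ i ∈ J, P i) := by
    intro J₁ J₂ h
    exact subset_antisymm ((key _ _).mp h.le) ((key _ _).mp h.ge)
  refine ⟨key, inj, ?_⟩
  have hr : {H : Subgroup G | ∃ J : Finset (Fin t), H = ⨆ i ∈ J, P i} =
      Set.range (fun J : Finset (Fin t) => ⨆ i ∈ J, P i) := by
    ext H
    simp [eq_comm]
  rw [hr, Nat.card_range_of_injective inj]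
  simp
end

section
/- Let p ≥ 5 be a prime. Then every Sylow subgroup of the projective special linear group PSL(2, p) can be generated by 2 elements. -/
/-- A finite group mapping injectively into a group, with image (up to conjugation) in a
subgroup `N` having a cyclic subgroup `C` of index at most two, is two-generated. -/
lemma two_gen_of {Q H : Type*} [Group Q] [Group H] (f : Q →* H) (hf : Function.Injective f)
    (N C : Subgroup H) [IsCyclic C] (hC : ∀ a ∈ N, ∀ b ∈ N, a ∉ C → b ∉ C → a * b⁻¹ ∈ C)
    (hfN : ∀ q, f q ∈ N) : ∃ x y : Q, Subgroup.closure {x, y} = ⊤ := by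
  have hcyc : IsCyclic (C.comap f) := by
    let g : C.comap f →* C := (f.comp (C.comap f).subtype).codRestrict C (fun x => x.2)
    refine isCyclic_of_injective g ?_
    intro a b hab
    exact Subtype.ext (hf (congrArg Subtype.val hab))
  obtain ⟨⟨d, hd⟩, hgen⟩ := hcyc.exists_generator
  have hD : ∀ z ∈ C.comap f, z ∈ Subgroup.zpowers d := by
    intro z hz
    obtain ⟨k, hk⟩ := Subgroup.mem_zpowers_iff.1 (hgen ⟨z, hz⟩)
    exact Subgroup.mem_zpowers_iff.2 ⟨k, congrArg Subtype.val hk⟩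
  by_cases h : ∀ z, z ∈ C.comap f
  · refine ⟨d, d, eq_top_iff.2 fun z _ => ?_⟩
    have := hD z (h z)
    rw [Subgroup.zpowers_eq_closure] at this
    simpa using this
  · push Not at h
    obtain ⟨x, hx⟩ := h
    refine ⟨d, x, eq_top_iff.2 fun z _ => ?_⟩
    have hle : Subgroup.zpowers d ≤ Subgroup.closure {d, x} := by
      rw [Subgroup.zpowers_eq_closure]; exact Subgroup.closure_mono (by simp)
    have hxm : x ∈ Subgroup.closure {d, x} := Subgroup.subset_closure (by simp)
    by_cases hz : z ∈ C.comap f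
    · exact hle (hD z hz)
    · have h1 : z * x⁻¹ ∈ C.comap f := by
        have := hC (f z) (hfN z) (f x) (hfN x) hz hx
        simpa using this
      have := mul_mem (hle (hD _ h1)) hxm
      simpa using this

lemma sylow_two_gen {S G H : Type*} [Group S] [Group G] [Group H] [Finite S] [Finite G] [Finite H]
    (φ : S →* G) (hφ : Function.Surjective φ) (ψ : S →* H) (hψ : Function.Injective ψ)
    (ℓ : ℕ) [Fact ℓ.Prime]
    (N C : Subgroup H) [IsCyclic C] (hC : ∀ a ∈ N, ∀ b ∈ N, a ∉ C → b ∉ C → a * b⁻¹ ∈ C)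
    (hN : ¬ ℓ ∣ N.index) (P : Sylow ℓ G) : 
    ∃ x y : (P : Subgroup G), Subgroup.closure {x, y} = ⊤ := by
  obtain ⟨Q, rfl⟩ := Sylow.mapSurjective_surjective hφ ℓ P
  let f : Q →* H := ψ.comp (Q : Subgroup S).subtype
  let _ : MulAction Q (H ⧸ N) := MulAction.compHom _ f
  obtain ⟨h, hh⟩ := Q.isPGroup'.nonempty_fixed_point_of_prime_not_dvd_card (H ⧸ N) hN
  obtain ⟨h, rfl⟩ := QuotientGroup.mk_surjective h
  have hfix : ∀ q : Q, h⁻¹ * f q * h ∈ N := by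
    intro q
    have h1 : f q • (h : H ⧸ N) = (h : H ⧸ N) := hh q
    rw [MulAction.Quotient.smul_coe, eq_comm, QuotientGroup.eq, smul_eq_mul, ← mul_assoc] at h1
    exact h1
  obtain ⟨x, y, hxy⟩ := two_gen_of ((MulAut.conj h⁻¹).toMonoidHom.comp f)
    ((MulAut.conj h⁻¹).injective.comp (hψ.comp Subtype.val_injective)) N C hC
    (fun q => by simpa using hfix q)
  let g : Q →* (Sylow.mapSurjective hφ Q : Subgroup G) :=
    φ.subgroupMap (Q : Subgroup S)
  have hg : Function.Surjective g := φ.subgroupMap_surjective _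
  refine ⟨g x, g y, ?_⟩
  have := congrArg (Subgroup.map g) hxy
  rw [MonoidHom.map_closure, Subgroup.map_top_of_surjective g hg, Set.image_pair] at this
  exact this


lemma card_GL2 (p : ℕ) [Fact p.Prime] :
    Nat.card (GL (Fin 2) (ZMod p)) = p * ((p - 1) * (p + 1)) * (p - 1) := by
  have hp : 2 ≤ p := (Fact.out : p.Prime).two_le
  rw [Matrix.card_GL_field (𝔽 := ZMod p) 2]
  obtain ⟨k, rfl⟩ : ∃ k, p = k + 1 := ⟨p - 1, by omega⟩
  have e1 : (k + 1) ^ 2 - 1 = k * (k + 2) := by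
    rw [Nat.sub_eq_iff_eq_add (Nat.one_le_pow _ _ (by omega))]; ring
  have e2 : (k + 1) ^ 2 - (k + 1) = (k + 1) * k := by
    rw [Nat.sub_eq_iff_eq_add (Nat.le_self_pow (by norm_num) _)]; ring
  simp only [ZMod.card, Fin.prod_univ_two, Fin.val_zero, Fin.val_one, pow_zero, pow_one, e1, e2,
    Nat.add_sub_cancel]
  ring

lemma card_SL2 (p : ℕ) [Fact p.Prime] :
    Nat.card (Matrix.SpecialLinearGroup (Fin 2) (ZMod p)) = p * ((p - 1) * (p + 1)) := by
  have hp : 2 ≤ p := (Fact.out : p.Prime).two_le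
  have h2 : Nat.card (Matrix.SpecialLinearGroup (Fin 2) (ZMod p)) * (p - 1) =
      Nat.card (GL (Fin 2) (ZMod p)) := by
    have hs : Function.Surjective (Matrix.GeneralLinearGroup.det (n := Fin 2) (R := ZMod p)) :=
      Matrix.GeneralLinearGroup.det_surjective
    have h3 := Subgroup.card_mul_index
      (Matrix.GeneralLinearGroup.det (n := Fin 2) (R := ZMod p)).ker
    rw [Subgroup.index_ker, MonoidHom.range_eq_top.2 hs, Subgroup.card_top] at h3
    rw [← h3, Nat.card_eq_fintype_card (α := (ZMod p)ˣ), ZMod.card_units]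
    congr 1
    refine Nat.card_congr (Equiv.ofBijective (fun g => ⟨Matrix.SpecialLinearGroup.toGL g, ?_⟩)
      ⟨?_, ?_⟩)
    · rw [MonoidHom.mem_ker]
      exact Units.ext g.2
    · intro a b hab
      exact Matrix.SpecialLinearGroup.toGL_injective (congrArg Subtype.val hab)
    · rintro ⟨g, hg⟩
      rw [MonoidHom.mem_ker] at hg
      exact ⟨⟨g.1, congrArg Units.val hg⟩, Subtype.ext (Units.ext rfl)⟩
  rw [card_GL2] at h2
  exact Nat.eq_of_mul_eq_mul_right (by omega) h2

section unip
open Matrix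

/-- The upper unipotent one-parameter subgroup of `SL(2, R)`. -/
def unipHom (R : Type*) [CommRing R] : Multiplicative R →* SpecialLinearGroup (Fin 2) R where
  toFun a := ⟨!![1, a.toAdd; 0, 1], by simp [det_fin_two]⟩
  map_one' := by
    ext i j; fin_cases i <;> fin_cases j <;> simp
  map_mul' a b := by
    refine Subtype.ext ?_
    change (!![1, a.toAdd + b.toAdd; 0, 1] : Matrix (Fin 2) (Fin 2) R) =
      !![1, a.toAdd; 0, 1] * !![1, b.toAdd; 0, 1]
    simp [add_comm]

/-- The diagonal torus of `SL(2, R)`. -/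
def torHom (R : Type*) [CommRing R] : Rˣ →* SpecialLinearGroup (Fin 2) R where
  toFun a := ⟨!![(a : R), 0; 0, ((a⁻¹ : Rˣ) : R)], by simp [det_fin_two]⟩
  map_one' := by
    ext i j; fin_cases i <;> fin_cases j <;> simp
  map_mul' a b := by
    refine Subtype.ext ?_
    change (!![((a * b : Rˣ) : R), 0; 0, (((a * b)⁻¹ : Rˣ) : R)] : Matrix (Fin 2) (Fin 2) R) =
      !![(a : R), 0; 0, ((a⁻¹ : Rˣ) : R)] * !![(b : R), 0; 0, ((b⁻¹ : Rˣ) : R)]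
    simp [mul_comm]

lemma torHom_coe (R : Type*) [CommRing R] (a : Rˣ) :
    (torHom R a : Matrix (Fin 2) (Fin 2) R) = !![(a : R), 0; 0, ((a⁻¹ : Rˣ) : R)] := rfl

/-- The Weyl element. -/
def weyl (R : Type*) [CommRing R] : SpecialLinearGroup (Fin 2) R :=
  ⟨!![0, 1; -1, 0], by simp [det_fin_two]⟩

lemma weyl_coe (R : Type*) [CommRing R] :
    (weyl R : Matrix (Fin 2) (Fin 2) R) = !![0, 1; -1, 0] := rfl

lemma weyl_tor (R : Type*) [CommRing R] (a : Rˣ) :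
    weyl R * torHom R a = torHom R a⁻¹ * weyl R := by
  refine Subtype.ext ?_
  change (!![0, 1; -1, 0] : Matrix (Fin 2) (Fin 2) R) * !![(a : R), 0; 0, ((a⁻¹ : Rˣ) : R)] =
    !![((a⁻¹ : Rˣ) : R), 0; 0, ((a⁻¹⁻¹ : Rˣ) : R)] * !![0, 1; -1, 0]
  simp

lemma weyl_sq (R : Type*) [CommRing R] : weyl R * weyl R = torHom R (-1) := by
  refine Subtype.ext ?_
  change (!![0, 1; -1, 0] : Matrix (Fin 2) (Fin 2) R) * !![0, 1; -1, 0] =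
    !![((-1 : Rˣ) : R), 0; 0, (((-1)⁻¹ : Rˣ) : R)]
  simp

lemma weyl_inv (R : Type*) [CommRing R] : (weyl R)⁻¹ = torHom R (-1) * weyl R := by
  rw [inv_eq_iff_mul_eq_one, ← mul_assoc, weyl_tor, mul_assoc, weyl_sq, ← map_mul]
  simp

/-- The monomial subgroup. -/
def monom (R : Type*) [CommRing R] : Subgroup (SpecialLinearGroup (Fin 2) R) where
  carrier := {g | ∃ a : Rˣ, g = torHom R a ∨ g = torHom R a * weyl R}
  one_mem' := ⟨1, Or.inl (by simp)⟩
  mul_mem' := by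
    rintro _ _ ⟨a, rfl | rfl⟩ ⟨b, rfl | rfl⟩
    · exact ⟨a * b, Or.inl (by simp)⟩
    · exact ⟨a * b, Or.inr (by simp [mul_assoc])⟩
    · exact ⟨a * b⁻¹, Or.inr (by rw [mul_assoc, weyl_tor, map_mul, mul_assoc])⟩
    · exact ⟨a * b⁻¹ * (-1), Or.inl (by
        rw [mul_assoc, ← mul_assoc (weyl R), weyl_tor, map_mul, map_mul, mul_assoc, mul_assoc,
          weyl_sq])⟩
  inv_mem' := by
    rintro _ ⟨a, rfl | rfl⟩
    · exact ⟨a⁻¹, Or.inl (by simp)⟩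
    · exact ⟨(-1) * a, Or.inr (by
        rw [_root_.mul_inv_rev, ← map_inv, weyl_inv, mul_assoc, weyl_tor, inv_inv, map_mul, mul_assoc])⟩

lemma tor_inj (R : Type*) [CommRing R] : Function.Injective (torHom R) := by
  intro a b h
  have := congrArg (fun g : SpecialLinearGroup (Fin 2) R => (g : Matrix (Fin 2) (Fin 2) R) 0 0) h
  exact Units.ext (by simpa [torHom_coe] using this)

lemma tor_ne (R : Type*) [CommRing R] [Nontrivial R] (a b : Rˣ) :
    torHom R a ≠ torHom R b * weyl R := by
  intro h
  have := congrArg (fun g : SpecialLinearGroup (Fin 2) R => (g : Matrix (Fin 2) (Fin 2) R) 0 0) h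
  simp [torHom_coe, weyl_coe] at this

lemma card_monom (p : ℕ) [Fact p.Prime] : Nat.card (monom (ZMod p)) = (p - 1) * 2 := by
  have : Nat.card ((ZMod p)ˣ × Bool) = (p - 1) * 2 := by
    rw [Nat.card_prod, Nat.card_eq_fintype_card, ZMod.card_units]; simp
  rw [← this]
  symm
  refine Nat.card_congr (Equiv.ofBijective (fun x => ⟨torHom _ x.1 * if x.2 then weyl _ else 1,
    x.1, ?_⟩) ⟨?_, ?_⟩)
  · rcases x with ⟨a, _ | _⟩ <;> simp
  · rintro ⟨a, _ | _⟩ ⟨b, _ | _⟩ h <;> have h := congrArg Subtype.val h <;> simp at h ⊢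
    · exact tor_inj _ h
    · exact tor_ne _ _ _ h
    · exact tor_ne _ _ _ h.symm
    · exact tor_inj _ h
  · rintro ⟨_, a, rfl | rfl⟩
    · exact ⟨(a, false), by simp⟩
    · exact ⟨(a, true), by simp⟩
end unip

section nonsplit
variable (F K : Type*) [Field F] [Field K] [Algebra F K]

/-- Semilinear maps `x ↦ a σ(x)`, as a subgroup of `GL_F(K)`. -/
def semi : Subgroup (K ≃ₗ[F] K) where
  carrier := {g | ∃ a : Kˣ, ∃ σ : K ≃ₐ[F] K, ∀ x, g x = a * σ x}
  one_mem' := ⟨1, 1, by simp⟩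
  mul_mem' := by
    rintro g h ⟨a, σ, hg⟩ ⟨b, τ, hh⟩
    refine ⟨a * Units.map σ b, σ * τ, fun x => ?_⟩
    simp [LinearEquiv.mul_apply, hg, hh, mul_assoc]
  inv_mem' := by
    rintro g ⟨a, σ, hg⟩
    refine ⟨Units.map σ.symm a⁻¹, σ⁻¹, fun x => ?_⟩
    apply g.injective
    have : g (g⁻¹ x) = x := g.apply_symm_apply x
    rw [this, hg]
    simp [AlgEquiv.aut_inv]

/-- Multiplication by units. -/
def mulHom : Kˣ →* (K ≃ₗ[F] K) := DistribMulAction.toModuleAut F K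

lemma mulHom_apply (a : Kˣ) (x : K) : mulHom F K a x = a * x := rfl

lemma card_semi : Nat.card (semi F K) = Nat.card Kˣ * Nat.card (K ≃ₐ[F] K) := by
  rw [← Nat.card_prod]
  symm
  refine Nat.card_congr (Equiv.ofBijective (fun x : Kˣ × (K ≃ₐ[F] K) =>
    (⟨mulHom F K x.1 * x.2.toLinearEquiv, x.1, x.2, fun y => rfl⟩ : semi F K)) ⟨?_, ?_⟩)
  · rintro ⟨a, σ⟩ ⟨b, τ⟩ h
    have h1 : ∀ x : K, a * σ x = b * τ x := fun x =>
      congrArg (fun g : semi F K => (g : K ≃ₗ[F] K) x) h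
    have hab : a = b := Units.ext (by simpa using h1 1)
    subst hab
    have : σ = τ := AlgEquiv.ext fun x => mul_left_cancel₀ a.ne_zero (h1 x)
    rw [this]
  · rintro ⟨g, a, σ, h⟩
    exact ⟨(a, σ), Subtype.ext (LinearEquiv.ext fun x => (h x).symm)⟩

lemma semi_mul (h2 : Nat.card (K ≃ₐ[F] K) = 2) : ∀ g ∈ semi F K, ∀ h ∈ semi F K,
    g ∉ (mulHom F K).range → h ∉ (mulHom F K).range → g * h⁻¹ ∈ (mulHom F K).range := by
  have key : ∀ g : K ≃ₗ[F] K, ∀ a : Kˣ, (∀ x, g x = a * x) → g ∈ (mulHom F K).range :=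
    fun g a hg => ⟨a, LinearEquiv.ext fun x => (hg x).symm⟩
  rintro g ⟨a, σ, hg⟩ h ⟨b, τ, hh⟩ hgn hhn
  have hσ : σ ≠ 1 := by rintro rfl; exact hgn (key g a hg)
  have hτ : τ ≠ 1 := by rintro rfl; exact hhn (key h b hh)
  have hστ : σ = τ := by
    obtain ⟨u, hu, hu'⟩ := Nat.card_eq_two_iff' (1 : K ≃ₐ[F] K) |>.1 h2
    rw [hu' σ hσ, hu' τ hτ]
  subst hστ
  refine key _ (a * b⁻¹) fun x => ?_
  obtain ⟨y, rfl⟩ := h.surjective x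
  have : (h⁻¹ : K ≃ₗ[F] K) (h y) = y := h.symm_apply_apply y
  rw [LinearEquiv.mul_apply, this, hg, hh]
  simp [mul_assoc]

end nonsplit

lemma index_arith {A B c : ℕ} {a : ℕ} (hc : 0 < c) (h : c * a = A) (hB : A = c * B) : a = B :=
  Nat.eq_of_mul_eq_mul_left hc (h.trans hB)

/-- For a prime `p ≥ 5`, every Sylow subgroup of `PSL(2, p)` can be generated by
two elements. -/
theorem stmt_10 (p : ℕ) (hp : p.Prime) (h5 : 5 ≤ p) (ℓ : ℕ) (hℓ : ℓ.Prime)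
    (P : Sylow ℓ (Matrix.ProjectiveSpecialLinearGroup (Fin 2) (ZMod p))) :
    ∃ x y : (P : Subgroup (Matrix.ProjectiveSpecialLinearGroup (Fin 2) (ZMod p))),
      Subgroup.closure {x, y} = ⊤ := by
  have : Fact p.Prime := ⟨hp⟩
  have : Fact ℓ.Prime := ⟨hℓ⟩
  let φ := QuotientGroup.mk' (Subgroup.center (Matrix.SpecialLinearGroup (Fin 2) (ZMod p)))
  have hφ : Function.Surjective φ := QuotientGroup.mk'_surjective _
  obtain ⟨k, hk⟩ : ∃ k, p = 2 * k + 1 := hp.odd_of_ne_two (by omega)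
  by_cases hlp : ℓ = p
  · let C := (unipHom (ZMod p)).range
    have hcyc : IsCyclic C :=
      isCyclic_of_surjective (unipHom (ZMod p)).rangeRestrict
        (unipHom (ZMod p)).rangeRestrict_surjective
    have hinj : Function.Injective (unipHom (ZMod p)) := by
      intro a b h
      exact congrArg (fun g : Matrix.SpecialLinearGroup (Fin 2) (ZMod p) =>
        (g : Matrix (Fin 2) (Fin 2) (ZMod p)) 0 1) h
    have hcard : Nat.card C = p := by
      rw [← Nat.card_congr (MonoidHom.ofInjective hinj).toEquiv]
      simp
    refine sylow_two_gen φ hφ (MonoidHom.id _) Function.injective_id ℓ C C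
      (fun a ha b hb hna => absurd ha hna) ?_ P
    have hi := C.card_mul_index
    rw [hcard, card_SL2] at hi
    rw [Nat.eq_of_mul_eq_mul_left (by omega) hi, hlp, hp.dvd_mul]
    rintro (h | h)
    · exact absurd (Nat.le_of_dvd (by omega) h) (by omega)
    · rw [Nat.dvd_add_right dvd_rfl] at h
      exact absurd (Nat.le_of_dvd (by omega) h) (by omega)
  have hlp' : ¬ ℓ ∣ p := fun h => hlp ((Nat.prime_dvd_prime_iff_eq hℓ hp).1 h)
  by_cases hs : ℓ ∣ k + 1
  · have hk' : ¬ ℓ ∣ k := fun h => hℓ.one_lt.ne'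
      (Nat.dvd_one.1 ((Nat.dvd_add_right h).1 hs))
    let K := GaloisField p 2
    have : Finite K := inferInstance
    have hfr : Module.finrank (ZMod p) K = 2 := GaloisField.finrank p two_ne_zero
    let b : Module.Basis (Fin 2) (ZMod p) K := Module.finBasisOfFinrankEq _ _ hfr
    let e : GL (Fin 2) (ZMod p) ≃* (K ≃ₗ[ZMod p] K) :=
      (Units.mapEquiv (LinearMap.toMatrixAlgEquiv b).symm.toMulEquiv).trans
        (LinearMap.GeneralLinearGroup.generalLinearEquiv (ZMod p) K)
    have : Finite (K ≃ₗ[ZMod p] K) := Finite.of_equiv _ e.toEquiv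
    have hgal : Nat.card (K ≃ₐ[ZMod p] K) = 2 := by
      rw [IsGalois.card_aut_eq_finrank, hfr]
    have hcyc : IsCyclic (mulHom (ZMod p) K).range :=
      isCyclic_of_surjective (mulHom (ZMod p) K).rangeRestrict
        (mulHom (ZMod p) K).rangeRestrict_surjective
    refine sylow_two_gen φ hφ (e.toMonoidHom.comp Matrix.SpecialLinearGroup.toGL)
      (e.injective.comp Matrix.SpecialLinearGroup.toGL_injective) ℓ (semi (ZMod p) K)
      (mulHom (ZMod p) K).range (semi_mul _ _ hgal) ?_ P
    have hi := (semi (ZMod p) K).card_mul_index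
    have hKu : Nat.card Kˣ = p ^ 2 - 1 := by
      rw [Nat.card_units, GaloisField.card p 2 two_ne_zero]
    have hK2 : p ^ 2 - 1 = 2 * k * (2 * k + 2) := by
      rw [Nat.sub_eq_iff_eq_add (Nat.one_le_pow _ _ (by omega)), hk]; ring
    rw [card_semi, hgal, hKu, hK2, ← Nat.card_congr e.toEquiv, card_GL2] at hi
    have hidx : (semi (ZMod p) K).index = p * k := by
      have hk0 : 0 < k := by omega
      refine index_arith (c := 2 * k * (2 * k + 2) * 2) (by positivity) hi ?_
      have e1 : p - 1 = 2 * k := by omega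
      have e2 : p + 1 = 2 * k + 2 := by omega
      rw [e1, e2]; ring
    rw [hidx, hℓ.dvd_mul]
    tauto
  · let C := (torHom (ZMod p)).range
    have hcyc : IsCyclic C :=
      isCyclic_of_surjective (torHom (ZMod p)).rangeRestrict
        (torHom (ZMod p)).rangeRestrict_surjective
    refine sylow_two_gen φ hφ (MonoidHom.id _) Function.injective_id ℓ (monom (ZMod p)) C ?_ ?_ P
    · rintro _ ⟨a, rfl | rfl⟩ _ ⟨b, rfl | rfl⟩ ha hb
      · exact absurd ⟨a, rfl⟩ ha
      · exact absurd ⟨a, rfl⟩ ha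
      · exact absurd ⟨b, rfl⟩ hb
      · exact ⟨a * b⁻¹, by simp [mul_assoc]⟩
    · have hi := (monom (ZMod p)).card_mul_index
      rw [card_monom, card_SL2] at hi
      have hidx : (monom (ZMod p)).index = p * (k + 1) := by
        have e1 : p - 1 = 2 * k := by omega
        have e2 : p + 1 = 2 * k + 2 := by omega
        refine index_arith (c := (p - 1) * 2) (by omega) hi ?_
        rw [e1, e2]; ring
      rw [hidx, hℓ.dvd_mul]
      tauto
end

section
/- Let q be an odd prime power with q ∉ {3, 5, 7, 9, 17}. Then at least one of the two integers (q − 1)/2 and (q + 1)/2 has at least two distinct prime divisors. -/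
lemma aux_pow {n r : ℕ} (hn : n ≠ 0) (hr : r.Prime) (hd : r ∣ n)
    (hc : n.primeFactors.card < 2) : ∃ k, n = r ^ k := by
  refine ⟨_, Nat.eq_prime_pow_of_unique_prime_dvd hn ?_⟩
  intro d hdp hdn
  exact Finset.card_le_one.mp (by omega) d (Nat.mem_primeFactors.mpr ⟨hdp, hdn, hn⟩)
    r (Nat.mem_primeFactors.mpr ⟨hr, hd, hn⟩)

lemma aux_three (b : ℕ) : 3 ^ b % 80 = 1 ∨ 3 ^ b % 80 = 3 ∨ 3 ^ b % 80 = 9 ∨ 3 ^ b % 80 = 27 := by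
  induction b with
  | zero => simp
  | succ k ih => rw [pow_succ]; omega

lemma aux_two {a m : ℕ} (h : m = 2 ^ a) : m = 1 ∨ m = 2 ∨ m = 4 ∨ m = 8 ∨ m % 16 = 0 := by
  subst h
  rcases Nat.lt_or_ge a 4 with h | h
  · interval_cases a <;> simp
  · have : 2 ^ 4 ∣ 2 ^ a := pow_dvd_pow 2 h
    omega

lemma aux_two_five {a m : ℕ} (h : m = 2 ^ a) : m % 5 ≠ 0 := by
  subst h
  intro h
  have := Nat.prime_five.dvd_of_dvd_pow (Nat.dvd_of_mod_eq_zero h)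
  omega

/-- If `q = p^f` is an odd prime power with `q ∉ {3, 5, 7, 9, 17}`, then at least one of
`(q-1)/2` and `(q+1)/2` has at least two distinct prime divisors. -/
theorem stmt_11 (q p f : ℕ) (hp : p.Prime) (hodd : Odd p) (hf : 1 ≤ f) (hq : q = p ^ f)
    (hq' : q ∉ ({3, 5, 7, 9, 17} : Set ℕ)) :
    2 ≤ ((q - 1) / 2).primeFactors.card ∨ 2 ≤ ((q + 1) / 2).primeFactors.card := by
  by_contra! hcon
  obtain ⟨h1, h2⟩ := hcon
  simp only [Set.mem_insert_iff, Set.mem_singleton_iff, not_or] at hq'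
  obtain ⟨m, hm⟩ : Odd q := hq ▸ hodd.pow
  have hq1 : q ≠ 1 := by
    rw [hq]; exact (Nat.one_lt_pow (by omega) hp.one_lt).ne'
  have e1 : (q - 1) / 2 = m := by omega
  have e2 : (q + 1) / 2 = m + 1 := by omega
  rw [e1] at h1
  rw [e2] at h2
  have m0 : m ≠ 0 := by omega
  have key : (∃ a, m = 2 ^ a) ∨ (∃ a, m + 1 = 2 ^ a) := by
    rcases Nat.even_or_odd m with h | h
    · exact .inl (aux_pow m0 Nat.prime_two h.two_dvd h1)
    · exact .inr (aux_pow (by omega) Nat.prime_two h.add_one.two_dvd h2)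
  have key3 : (∃ b, m = 3 ^ b) ∨ (∃ b, m + 1 = 3 ^ b) ∨ (∃ b, q = 3 ^ b) := by
    by_cases c1 : 3 ∣ m
    · exact .inl (aux_pow m0 Nat.prime_three c1 h1)
    by_cases c2 : 3 ∣ m + 1
    · exact .inr (.inl (aux_pow (by omega) Nat.prime_three c2 h2))
    have c4 : m % 3 = 1 := by clear key; omega
    have c3 : 3 ∣ q := ⟨2 * (m / 3) + 1, by clear key; omega⟩
    rw [hq] at c3
    have := (Nat.prime_dvd_prime_iff_eq Nat.prime_three hp).mp (Nat.prime_three.dvd_of_dvd_pow c3)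
    exact .inr (.inr ⟨f, by rw [hq, this]⟩)
  rcases key with ⟨a, ha⟩ | ⟨a, ha⟩ <;> have A := aux_two ha <;> have B := aux_two_five ha <;>
    rcases key3 with ⟨b, hb⟩ | ⟨b, hb⟩ | ⟨b, hb⟩ <;> have C := aux_three b <;>
    rw [← hb] at C <;> omega
end
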